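/- Let K be a geometric simplicial complex in ℝ^d (in the sense of Mathlib's Geometry.SimplicialComplex) with finitely many and at least one face, and suppose its underlying space (the union of the convex hulls of its faces) is homeomorphic to the unit sphere {x ∈ ℝ^n : ‖x‖ = 1} for some n ≥ 1. Then there is no vertex p of K that belongs to every facet (maximal face) of K. -/

import Mathlib

/-- `K` is an abstract simplicial complex: its faces are nonempty finite sets,
closed under taking nonempty subsets. -/
def IsSimpComplex {A : Type*} (K : Set (Finset A)) : Prop :=
  (∀ σ ∈ K, σ.Nonempty) ∧ ∀ σ ∈ K, ∀ τ : Finset A, τ ⊆ σ → τ.Nonempty → τ ∈ K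

/-- `K` is a simplicial complex on the vertex set `V`: every face is a subset of `V`. -/
def OnVertexSet {A : Type*} (K : Set (Finset A)) (V : Set A) : Prop :=
  ∀ σ ∈ K, ∀ x ∈ σ, x ∈ V

/-- The link of a face `σ` of `K`: `lk_K(σ) = {τ ∈ K : τ ∪ σ ∈ K and τ ∩ σ = ∅}`. -/
def linkOf {A : Type*} [DecidableEq A] (K : Set (Finset A)) (σ : Finset A) :
    Set (Finset A) :=
  {τ | τ ∈ K ∧ τ ∪ σ ∈ K ∧ τ ∩ σ = ∅}

/-- The star of a face `σ` of `K`: `st_K(σ) = {τ ∈ K : τ ∪ σ ∈ K}`. -/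
def starOf {A : Type*} [DecidableEq A] (K : Set (Finset A)) (σ : Finset A) :
    Set (Finset A) :=
  {τ | τ ∈ K ∧ τ ∪ σ ∈ K}

/-- The join of two simplicial complexes: the nonempty sets `σ ∪ τ` with
`σ ∈ K ∪ {∅}` and `τ ∈ L ∪ {∅}`. -/
def joinC {A : Type*} [DecidableEq A] (K L : Set (Finset A)) : Set (Finset A) :=
  {ρ | ρ.Nonempty ∧ ∃ σ τ : Finset A, (σ ∈ K ∨ σ = ∅) ∧ (τ ∈ L ∨ τ = ∅) ∧ ρ = σ ∪ τ}

/-- The wedge of `K` at the vertex `v`, introducing the new vertex `v'`: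
`wed_v(K) = (I ∗ lk_K(v)) ∪ (∂I ∗ K₋ᵥ)` where `I` is the full complex on `{v, v'}`,
`∂I` the complex with faces `{v}, {v'}`, and `K₋ᵥ = {σ ∈ K : v ∉ σ}`. -/
def wed {A : Type*} [DecidableEq A] (K : Set (Finset A)) (v v' : A) : Set (Finset A) :=
  joinC ({{v}, {v'}, {v, v'}} : Set (Finset A)) (linkOf K {v}) ∪
    joinC ({{v}, {v'}} : Set (Finset A)) {σ | σ ∈ K ∧ v ∉ σ}

/-- The boundary complex `∂σ` of a finite set `σ`: all nonempty proper subsets of `σ`. -/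
def bdry {A : Type*} (σ : Finset A) : Set (Finset A) :=
  {τ | τ ⊂ σ ∧ τ.Nonempty}

/-- The stellar subdivision of `K` at the face `σ`, with new vertex `w`:
`ss_σ(K) = (K \ st_K(σ)) ∪ ({w} ∗ ∂σ ∗ lk_K(σ))`. -/
def stellar {A : Type*} [DecidableEq A] (K : Set (Finset A)) (σ : Finset A) (w : A) :
    Set (Finset A) :=
  (K \ starOf K σ) ∪ joinC ({{w}} : Set (Finset A)) (joinC (bdry σ) (linkOf K σ))

/-- `F` is a facet (a face maximal under inclusion) of `K`. -/
def IsFacetOf {A : Type*} (K : Set (Finset A)) (F : Finset A) : Prop :=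
  F ∈ K ∧ ∀ G ∈ K, F ⊆ G → F = G

/-- A minimal non-face of `K` with respect to the vertex set `V`: a finite subset
`τ ⊆ V` with `τ ∉ K` such that every nonempty proper subset of `τ` is a face of `K`. -/
def IsMinNonFace {A : Type*} (K : Set (Finset A)) (V : Set A) (τ : Finset A) : Prop :=
  (∀ x ∈ τ, x ∈ V) ∧ τ ∉ K ∧ ∀ ρ : Finset A, ρ ⊂ τ → ρ.Nonempty → ρ ∈ K

/-- Perform successive wedge operations at the vertex `(v, 0)`; the `t`-th introduces
the new vertex `(v, t)`.  Here the pair `(v, t)` encodes the vertex copy `v⁽ᵗ⁾`,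
identifying `v⁽⁰⁾` with `v`. -/
def wedIter (K : Set (Finset (ℕ × ℕ))) (v : ℕ) : ℕ → Set (Finset (ℕ × ℕ))
  | 0 => K
  | t + 1 => wed (wedIter K v t) (v, 0) (v, t + 1)

/-- The `J`-construction `K(J)` of a simplicial complex `K` on `[m] = {1, …, m}`
(the vertex `v` being encoded as the pair `(v, 0)`): for each `v ∈ [m]`, perform
`j v - 1` successive wedge operations at `v`, the `t`-th of which introduces the
new vertex `v⁽ᵗ⁾ = (v, t)`. -/
def KJ (K : Set (Finset (ℕ × ℕ))) (m : ℕ) (j : ℕ → ℕ) : Set (Finset (ℕ × ℕ)) :=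
  (List.range m).foldl (fun L v => wedIter L (v + 1) (j (v + 1) - 1)) K

section NoRetraction

open Metric Set Filter Topology MeasureTheory

/-- The determinant of `1 + t • L` is a polynomial in `t` of degree at most the dimension. -/
lemma exists_polynomial_eval_eq_det_one_add_smul {E : Type*} [NormedAddCommGroup E]
    [NormedSpace ℝ E] [FiniteDimensional ℝ E] (L : E →L[ℝ] E) :
    ∃ p : Polynomial ℝ, p.natDegree ≤ Module.finrank ℝ E ∧
      ∀ t : ℝ, p.eval t = (1 + t • L).det := by
  let b := Module.finBasis ℝ E
  let A := LinearMap.toMatrix b b (L : E →ₗ[ℝ] E)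
  refine ⟨_, (Polynomial.natDegree_det_X_add_C_le A 1).trans_eq (Fintype.card_fin _), fun t ↦ ?_⟩
  rw [← Polynomial.coe_evalRingHom, RingHom.map_det, ContinuousLinearMap.det,
    ← LinearMap.det_toMatrix b]
  congr 1
  ext i j
  rcases eq_or_ne i j with rfl | hij
  · simp [A, LinearMap.toMatrix_apply]
    ring
  · simp [A, LinearMap.toMatrix_apply, hij]
    ring

/-- Perturbations of the identity by small multiples of a `C¹` map vanishing on the unit sphere
preserve the volume of the unit ball. -/
lemma exists_pos_integral_det_one_add_smul_fderiv {E : Type*} [NormedAddCommGroup E]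
    [NormedSpace ℝ E] [FiniteDimensional ℝ E] [MeasurableSpace E] [BorelSpace E]
    (μ : Measure E) [μ.IsAddHaarMeasure] {g : E → E} (hg : ContDiff ℝ 1 g)
    (hg0 : ∀ x, ‖x‖ = 1 → g x = 0) :
    ∃ δ > 0, ∀ t : ℝ, 0 < t → t ≤ δ →
      ∫ x in ball 0 1, (1 + t • fderiv ℝ g x).det ∂μ = μ.real (ball 0 1) := by
  have hcont : Continuous (fderiv ℝ g) := hg.continuous_fderiv one_ne_zero
  obtain ⟨C, hC⟩ := (isCompact_closedBall (0 : E) 1).exists_bound_of_continuousOn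
    hcont.continuousOn
  obtain ⟨M, hM⟩ : ∃ M : NNReal, M = max C 1 := ⟨⟨max C 1, by positivity⟩, rfl⟩
  have hM1 : (1 : ℝ) ≤ M := by rw [hM]; exact le_max_right _ _
  have hMb : ∀ x ∈ closedBall (0 : E) 1, ‖fderiv ℝ g x‖ ≤ M := fun x hx ↦ by
    rw [hM]; exact (hC x hx).trans (le_max_left _ _)
  have hlip : LipschitzOnWith M g (closedBall 0 1) :=
    (convex_closedBall (0 : E) 1).lipschitzOnWith_of_nnnorm_fderiv_le
      (fun x _ ↦ hg.differentiable one_ne_zero x) fun x hx ↦ hMb x hx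
  -- extend by zero
  let h : E → E := (closedBall (0 : E) 1).indicator g
  have hcross : ∀ x ∈ closedBall (0 : E) 1, ∀ y ∉ closedBall (0 : E) 1,
      ‖g x‖ ≤ M * ‖x - y‖ := by
    intro x hx y hy
    obtain ⟨z, hz, hz1⟩ : ∃ z ∈ segment ℝ x y, ‖z‖ = 1 := by
      have := (convex_segment (𝕜 := ℝ) x y).isPreconnected.intermediate_value
        (left_mem_segment ℝ x y) (right_mem_segment ℝ x y) continuous_norm.continuousOn
      simp only [mem_closedBall, dist_zero_right, not_le] at hx hy
      exact this ⟨hx, hy.le⟩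
    have h1 := hlip.dist_le_mul x hx z (by simp [hz1])
    rw [hg0 z hz1, dist_zero_right] at h1
    refine h1.trans ?_
    have h2 := dist_add_dist_of_mem_segment hz
    rw [← dist_eq_norm]
    gcongr
    linarith [dist_nonneg (x := z) (y := y)]
  have hh : ∀ x y, ‖h x - h y‖ ≤ M * ‖x - y‖ := by
    intro x y
    by_cases hx : x ∈ closedBall (0 : E) 1 <;> by_cases hy : y ∈ closedBall (0 : E) 1
    · simpa [h, hx, hy, dist_eq_norm] using hlip.dist_le_mul x hx y hy
    · simpa only [h, indicator_of_mem hx, indicator_of_notMem hy, sub_zero] using hcross x hx y hy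
    · simpa only [h, indicator_of_mem hy, indicator_of_notMem hx, zero_sub, norm_neg,
        norm_sub_rev] using hcross y hy x hx
    · simp only [h, indicator_of_notMem hx, indicator_of_notMem hy, sub_zero, norm_zero]
      positivity
  have hball : ∀ x ∉ ball (0 : E) 1, h x = 0 := by
    intro x hx
    by_cases hx' : x ∈ closedBall (0 : E) 1
    · simp only [h, indicator_of_mem hx']
      simp only [mem_ball, mem_closedBall, dist_zero_right, not_lt] at hx hx'
      exact hg0 x (le_antisymm hx' hx)
    · exact indicator_of_notMem hx' _
  obtain ⟨η, hη, hdet⟩ : ∃ η > 0, ∀ A : E →L[ℝ] E, ‖A‖ < η → 0 < (1 + A).det := by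
    have h1 : ContinuousAt (fun A : E →L[ℝ] E ↦ (1 + A).det) 0 :=
      (ContinuousLinearMap.continuous_det.comp (continuous_const.add continuous_id)).continuousAt
    have h2 : ∀ᶠ A : E →L[ℝ] E in 𝓝 0, 0 < (1 + A).det :=
      h1.eventually (lt_mem_nhds (by simp [ContinuousLinearMap.det]))
    obtain ⟨η, hη, H⟩ := Metric.eventually_nhds_iff.1 h2
    exact ⟨η, hη, fun A hA ↦ H (by simpa using hA)⟩
  refine ⟨min (η / 2) (1 / 2) / M, by positivity, fun t ht htδ ↦ ?_⟩
  have htM : t * M ≤ min (η / 2) (1 / 2) := (le_div_iff₀ (by positivity)).1 htδ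
  have htM1 : t * M < 1 := by linarith [min_le_right (η / 2) (1 / 2)]
  have htMη : t * M < η := by linarith [min_le_left (η / 2) (1 / 2)]
  lift t to NNReal using ht.le
  let F : E → E := fun x ↦ x + (t : ℝ) • h x
  have hF : ApproximatesLinearOn F ((ContinuousLinearEquiv.refl ℝ E : E ≃L[ℝ] E) : E →L[ℝ] E)
      univ (t * M) := by
    intro x _ y _
    have : F x - F y - (x - y) = (t : ℝ) • (h x - h y) := by simp only [F, smul_sub]; abel
    simp only [ContinuousLinearEquiv.coe_refl, ContinuousLinearMap.coe_id', id_eq]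
    rw [this, norm_smul, Real.norm_of_nonneg ht.le, NNReal.coe_mul, mul_assoc]
    gcongr
    exact hh x y
  have hc : Subsingleton E ∨ ((t * M : NNReal)) <
      ‖((ContinuousLinearEquiv.refl ℝ E).symm : E →L[ℝ] E)‖₊⁻¹ := by
    rcases subsingleton_or_nontrivial E with hE | hE
    · exact .inl hE
    · right
      rw [← NNReal.coe_lt_coe]
      simpa using mod_cast htM1
  have hinj : Function.Injective F := injOn_univ.1 (hF.injOn hc)
  have hsurj : Function.Surjective F := hF.surjective hc
  have hfix : ∀ x ∉ ball (0 : E) 1, F x = x := fun x hx ↦ by simp [F, hball x hx]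
  have himage : F '' ball 0 1 = ball 0 1 := by
    ext y
    constructor
    · rintro ⟨x, hx, rfl⟩
      by_contra hy
      exact hy ((hinj (hfix _ hy)).symm ▸ hx)
    · intro hy
      obtain ⟨x, rfl⟩ := hsurj y
      refine ⟨x, ?_, rfl⟩
      by_contra hx
      exact hx (hfix x hx ▸ hy)
  have hderiv : ∀ x ∈ ball (0 : E) 1,
      HasFDerivWithinAt F (1 + (t : ℝ) • fderiv ℝ g x) (ball 0 1) x := by
    intro x hx
    have h1 : HasFDerivAt (fun x ↦ x + (t : ℝ) • g x) (1 + (t : ℝ) • fderiv ℝ g x) x :=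
      (hasFDerivAt_id x).add ((hg.differentiable one_ne_zero x).hasFDerivAt.const_smul t)
    refine h1.hasFDerivWithinAt.congr' (fun y hy ↦ ?_) hx
    simp only [F, h, indicator_of_mem (ball_subset_closedBall hy)]
  have key := integral_image_eq_integral_abs_det_fderiv_smul μ measurableSet_ball hderiv
    hinj.injOn (fun _ ↦ (1 : ℝ))
  rw [himage, setIntegral_const, smul_eq_mul, mul_one] at key
  rw [key]
  refine setIntegral_congr_fun measurableSet_ball fun x hx ↦ ?_
  have hpos : 0 < (1 + (t : ℝ) • fderiv ℝ g x).det := by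
    refine hdet _ (lt_of_le_of_lt ?_ htMη)
    rw [norm_smul, Real.norm_of_nonneg ht.le]
    gcongr
    exact hMb x (ball_subset_closedBall hx)
  simp [abs_of_pos hpos]

/-- The integral of the Jacobian of a `C¹` map fixing the unit sphere pointwise is the volume of
the unit ball. -/
lemma integral_det_one_add_fderiv_of_eq_zero_on_sphere {E : Type*} [NormedAddCommGroup E]
    [NormedSpace ℝ E] [FiniteDimensional ℝ E] [MeasurableSpace E] [BorelSpace E]
    (μ : Measure E) [μ.IsAddHaarMeasure] {g : E → E} (hg : ContDiff ℝ 1 g)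
    (hg0 : ∀ x, ‖x‖ = 1 → g x = 0) :
    ∫ x in ball 0 1, (1 + fderiv ℝ g x).det ∂μ = μ.real (ball 0 1) := by
  obtain ⟨δ, hδ, H⟩ := exists_pos_integral_det_one_add_smul_fderiv μ hg hg0
  let s := Finset.range (Module.finrank ℝ E + 1)
  let v : ℕ → ℝ := fun i ↦ δ / (i + 1)
  let w : ℕ → ℝ := fun i ↦ (Lagrange.basis s v i).eval 1
  have hv : InjOn v s := by
    intro i _ j _ hij
    simp only [v] at hij
    field_simp at hij
    exact_mod_cast (add_right_cancel hij).symm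
  have hw : ∑ i ∈ s, w i = 1 := by
    rw [← Polynomial.eval_finsetSum, Lagrange.sum_basis hv (by simp [s]), Polynomial.eval_one]
  have hL : ∀ L : E →L[ℝ] E, (1 + L).det = ∑ i ∈ s, w i * (1 + v i • L).det := by
    intro L
    obtain ⟨p, hp, hpe⟩ := exists_polynomial_eval_eq_det_one_add_smul L
    have hdeg : p.degree < s.card := by
      refine p.degree_le_natDegree.trans_lt ?_
      simp only [s, Finset.card_range]
      exact_mod_cast Nat.lt_succ_of_le hp
    have := congrArg (Polynomial.eval 1) (Lagrange.eq_interpolate hv hdeg)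
    rw [hpe, one_smul, Lagrange.interpolate_apply, Polynomial.eval_finsetSum] at this
    rw [this]
    refine Finset.sum_congr rfl fun i _ ↦ ?_
    rw [Polynomial.eval_mul, Polynomial.eval_C, hpe, mul_comm]
  have hL_int : ∀ t : ℝ, IntegrableOn (fun x ↦ (1 + t • fderiv ℝ g x).det) (ball 0 1) μ := by
    intro t
    have hcont : Continuous fun x ↦ (1 + t • fderiv ℝ g x).det :=
      ContinuousLinearMap.continuous_det.comp
        (continuous_const.add ((hg.continuous_fderiv one_ne_zero).const_smul t))
    exact (hcont.continuousOn.integrableOn_compact (isCompact_closedBall (0 : E) 1)).mono_set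
      ball_subset_closedBall
  simp only [fun x ↦ hL (fderiv ℝ g x)]
  rw [integral_finsetSum _ fun i _ ↦ (hL_int (v i)).const_mul (w i)]
  simp_rw [integral_const_mul]
  calc ∑ i ∈ s, w i * ∫ x in ball 0 1, (1 + v i • fderiv ℝ g x).det ∂μ
      = ∑ i ∈ s, w i * μ.real (ball 0 1) := by
        refine Finset.sum_congr rfl fun i _ ↦ ?_
        rw [H (v i) (by positivity) (div_le_self hδ.le (by simp))]
    _ = μ.real (ball 0 1) := by rw [← Finset.sum_mul, hw, one_mul]

lemma det_fderiv_eq_zero_of_norm_eq_one {E : Type*} [NormedAddCommGroup E]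
    [InnerProductSpace ℝ E] [FiniteDimensional ℝ E] {N : E → E} (hN : Differentiable ℝ N)
    (hN1 : ∀ x, ‖N x‖ = 1) (x : E) : (fderiv ℝ N x).det = 0 := by
  by_contra hdet
  have hsurj : Function.Surjective (fderiv ℝ N x) :=
    (LinearMap.equivOfDetNeZero (fderiv ℝ N x : E →ₗ[ℝ] E) hdet).surjective
  obtain ⟨u, hu⟩ := hsurj (N x)
  have h1 : HasFDerivAt (fun y ↦ ‖N y‖ ^ 2) _ x := (hN x).hasFDerivAt.norm_sq
  have h2 : HasFDerivAt (fun y ↦ ‖N y‖ ^ 2) (0 : E →L[ℝ] ℝ) x := by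
    simp only [hN1]
    exact hasFDerivAt_const _ _
  have h3 := DFunLike.congr_fun (h1.unique h2) u
  simp [hu, hN1] at h3

/-- There is no `C¹` map to the unit sphere restricting to the identity on the unit sphere. -/
lemma not_exists_contDiff_retraction_sphere {E : Type*} [NormedAddCommGroup E]
    [InnerProductSpace ℝ E] [FiniteDimensional ℝ E] :
    ¬ ∃ N : E → E, ContDiff ℝ 1 N ∧ (∀ x, ‖N x‖ = 1) ∧ ∀ x, ‖x‖ = 1 → N x = x := by
  rintro ⟨N, hN, hN1, hNid⟩
  borelize E
  have h := integral_det_one_add_fderiv_of_eq_zero_on_sphere (Measure.addHaar : Measure E)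
    (g := fun x ↦ N x - x) (hN.sub contDiff_id) fun x hx ↦ by rw [hNid x hx, sub_self]
  have hd : ∀ x, (1 + fderiv ℝ (fun x ↦ N x - x) x).det = 0 := by
    intro x
    have : fderiv ℝ (fun x ↦ N x - x) x = fderiv ℝ N x - 1 :=
      ((hN.differentiable one_ne_zero x).hasFDerivAt.sub (hasFDerivAt_id x)).fderiv
    rw [this, add_sub_cancel]
    exact det_fderiv_eq_zero_of_norm_eq_one (hN.differentiable one_ne_zero) hN1 x
  simp only [hd, integral_zero] at h
  exact (ENNReal.toReal_pos (measure_ball_pos _ _ one_pos).ne' measure_ball_lt_top.ne).ne h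

/-- The unit sphere of a finite-dimensional real inner product space is not contractible. -/
theorem not_contractibleSpace_sphere {E : Type*} [NormedAddCommGroup E]
    [InnerProductSpace ℝ E] [FiniteDimensional ℝ E] :
    ¬ ContractibleSpace (sphere (0 : E) 1) := by
  classical
  intro hE
  obtain ⟨c, ⟨H⟩⟩ := id_nullhomotopic (sphere (0 : E) 1)
  let u : E → sphere (0 : E) 1 := fun x ↦
    if hx : x = 0 then c else ⟨‖x‖⁻¹ • x, by simp [norm_smul, hx]⟩
  have hu : ∀ x, x ≠ 0 → (u x : E) = ‖x‖⁻¹ • x := fun x hx ↦ by simp [u, hx]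
  have hu_cont : ∀ x, x ≠ 0 → ContinuousAt u x := by
    intro x hx
    rw [Topology.IsEmbedding.subtypeVal.continuousAt_iff]
    have : ContinuousAt (fun x : E ↦ ‖x‖⁻¹ • x) x :=
      (continuous_norm.continuousAt.inv₀ (norm_ne_zero_iff.2 hx)).smul continuousAt_id
    refine this.congr ?_
    filter_upwards [isOpen_ne.mem_nhds hx] with y hy
    exact (hu y hy).symm
  let τ : E → unitInterval := fun x ↦ projIcc 0 1 zero_le_one (2 - 4 * ‖x‖)
  have hτ : Continuous τ := continuous_projIcc.comp (by fun_prop)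
  let G : E → E := fun x ↦ H (τ x, u x)
  have hG1 : ∀ x, ‖G x‖ = 1 := fun x ↦ mem_sphere_zero_iff_norm.1 (H (τ x, u x)).2
  have hGout : ∀ x, 1 / 2 ≤ ‖x‖ → G x = ‖x‖⁻¹ • x := by
    intro x hx
    have h0 : τ x = 0 := projIcc_of_le_left _ (by linarith)
    have hx0 : x ≠ 0 := norm_pos_iff.1 (by linarith)
    simp only [G, h0, H.apply_zero, ContinuousMap.id_apply, hu x hx0]
  have hG : Continuous G := by
    rw [continuous_iff_continuousAt]
    intro x
    rcases eq_or_ne x 0 with rfl | hx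
    · refine (continuousAt_const (y := (c : E))).congr ?_
      filter_upwards [ball_mem_nhds (0 : E) (show (0 : ℝ) < 1 / 4 by norm_num)] with y hy
      have h1 : τ y = 1 := projIcc_of_right_le _ (by
        rw [mem_ball_zero_iff] at hy; linarith)
      simp [G, h1]
    · exact continuous_subtype_val.continuousAt.comp
        (H.continuous.continuousAt.comp (hτ.continuousAt.prodMk (hu_cont x hx)))
  have hradial : ContDiffOn ℝ 1 G {x | 1 / 2 < ‖x‖} := by
    have : ContDiffOn ℝ 1 (fun x : E ↦ ‖x‖⁻¹ • x) {x | 1 / 2 < ‖x‖} := by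
      intro x hx
      have hx0 : x ≠ 0 := norm_pos_iff.1 (lt_trans (by norm_num) hx)
      exact (((contDiffAt_norm ℝ hx0).inv (norm_ne_zero_iff.2 hx0)).smul
        contDiffAt_id).contDiffWithinAt
    exact this.congr fun x hx ↦ hGout x (le_of_lt hx)
  obtain ⟨g, hg, hgG, hgS, -⟩ := hG.exists_contDiff_approx_and_eqOn 1
    (continuous_const (y := (1 / 2 : ℝ))) (fun _ ↦ by norm_num)
    (S := {x : E | 1 ≤ ‖x‖}) (U := {x : E | 1 / 2 < ‖x‖})
    (isClosed_le continuous_const continuous_norm)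
    ((isOpen_lt continuous_const continuous_norm).mem_nhdsSet.2 fun x hx ↦
      one_half_lt_one.trans_le (show 1 ≤ ‖x‖ from hx)) hradial
  have hg0 : ∀ x, g x ≠ 0 := by
    intro x hx
    have := hgG x
    rw [hx, dist_zero_left, hG1] at this
    norm_num at this
  refine not_exists_contDiff_retraction_sphere
    ⟨fun x ↦ ‖g x‖⁻¹ • g x, ?_, fun x ↦ ?_, fun x hx ↦ ?_⟩
  · exact ((hg.norm ℝ hg0).inv fun x ↦ norm_ne_zero_iff.2 (hg0 x)).smul hg
  · simp [norm_smul, hg0 x]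
  · have : g x = x := by
      rw [hgS (show 1 ≤ ‖x‖ from hx.ge), hGout x (by rw [hx]; norm_num), hx, inv_one, one_smul]
    simp only [this, hx, inv_one, one_smul]

end NoRetraction

/-- A finite simplicial complex all of whose facets contain `p` is star convex at `p`. -/
lemma Geometry.SimplicialComplex.starConvex_space_of_forall_mem_facet {E : Type*}
    [AddCommGroup E] [Module ℝ E] {K : Geometry.SimplicialComplex ℝ E} (hfin : K.faces.Finite)
    {p : E} (hp : ∀ F ∈ K.faces, (∀ G ∈ K.faces, F ⊆ G → F = G) → p ∈ F) :
    StarConvex ℝ p K.space := by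
  intro x hx
  obtain ⟨s, hs, hxs⟩ := Geometry.SimplicialComplex.mem_space_iff.1 hx
  obtain ⟨F, hsF, hF⟩ := hfin.exists_le_maximal hs
  have hpF : p ∈ F := hp F hF.prop fun G hG hFG ↦ hF.eq_of_le hG hFG
  intro a b ha hb hab
  exact Geometry.SimplicialComplex.convexHull_subset_space hF.prop
    ((convex_convexHull ℝ _) (subset_convexHull ℝ _ hpF) (convexHull_mono hsF hxs) ha hb hab)

theorem stmt14 (d n : ℕ) (hn : 1 ≤ n)
    (K : Geometry.SimplicialComplex ℝ (EuclideanSpace ℝ (Fin d)))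
    (hfin : K.faces.Finite) (hne : K.faces.Nonempty)
    (hhomeo : Nonempty
      (K.space ≃ₜ ({x : EuclideanSpace ℝ (Fin n) | ‖x‖ = 1} : Set (EuclideanSpace ℝ (Fin n))))) :
    ¬ ∃ p ∈ K.vertices, ∀ F ∈ K.faces, (∀ G ∈ K.faces, F ⊆ G → F = G) → p ∈ F := by
  rintro ⟨p, hpv, hp⟩
  obtain ⟨e⟩ := hhomeo
  have hcontr : ContractibleSpace K.space :=
    (Geometry.SimplicialComplex.starConvex_space_of_forall_mem_facet hfin hp).contractibleSpace
      ⟨p, Geometry.SimplicialComplex.vertices_subset_space hpv⟩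
  have hset : {x : EuclideanSpace ℝ (Fin n) | ‖x‖ = 1} = Metric.sphere 0 1 := by
    ext x
    simp
  exact not_contractibleSpace_sphere (e.trans (Homeomorph.setCongr hset)).symm.contractibleSpace
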